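/- Let g ∈ L¹(ℝⁿ) ∩ L²(ℝⁿ), r > 0, t ∈ ℝⁿ, and let M, P : L²(ℝⁿ) → L²(ℝⁿ) be maps that commute with the θ-translation T_u^θ for every u ∈ ℝⁿ. Then for every f ∈ L²(ℝⁿ), D_r^θ P M ((T_t^θ f) ⋆_θ g) = e^{πi (t·t) cot θ} e^{−πi ((t·t)/r²) cot θ} T_{t/r}^θ D_r^θ P M (f ⋆_θ g) in L²(ℝⁿ). -/

import Mathlib

noncomputable section

open MeasureTheory Complex
open scoped InnerProductSpace ENNReal

abbrev Rn (n : ℕ) : Type := EuclideanSpace ℝ (Fin n)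

variable {n : ℕ}

/-- θ-translation: `T_s^θ f (t) = e^{-2πi (s·(t-s)) cot θ} f (t-s)`. -/
def thetaTrans (θ : ℝ) (s : Rn n) (f : Rn n → ℂ) : Rn n → ℂ :=
  fun t => Complex.exp (((-2 * Real.pi * ⟪s, t - s⟫_ℝ * Real.cot θ : ℝ) : ℂ) * Complex.I) * f (t - s)

/-- Chirp modulation `C_θ f (t) = e^{πi (t·t) cot θ} f(t)`. -/
def chirp (θ : ℝ) (f : Rn n → ℂ) : Rn n → ℂ :=
  fun t => Complex.exp (((Real.pi * ⟪t, t⟫_ℝ * Real.cot θ : ℝ) : ℂ) * Complex.I) * f t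

/-- θ-convolution `(f ⋆_θ g)(x) = |sin θ|^{-n/2} ∫ f(s) T_s^θ g (x) ds`. -/
def thetaConv (θ : ℝ) (f g : Rn n → ℂ) : Rn n → ℂ :=
  fun x => ((|Real.sin θ| ^ (-(n : ℝ) / 2) : ℝ) : ℂ) * ∫ s, f s * thetaTrans θ s g x

/-- Unitary dilation `D_r f (x) = r^{n/2} f (r x)`. -/
def dil (r : ℝ) (f : Rn n → ℂ) : Rn n → ℂ :=
  fun x => ((r ^ ((n : ℝ) / 2) : ℝ) : ℂ) * f (r • x)

/-- θ-dilation `D_r^θ = C_{-θ} ∘ D_r ∘ C_θ`. -/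
def thetaDil (θ r : ℝ) (f : Rn n → ℂ) : Rn n → ℂ := chirp (-θ) (dil r (chirp θ f))

theorem thetaConv_thetaTrans_left (θ : ℝ) (t : Rn n) (f g : Rn n → ℂ) :
    thetaConv θ (thetaTrans θ t f) g = thetaTrans θ t (thetaConv θ f g) := by
  funext x
  simp only [thetaConv, thetaTrans]
  rw [← integral_add_right_eq_self _ t, mul_left_comm]
  congr 1
  rw [← integral_const_mul]
  congr 1
  funext s
  rw [add_sub_cancel_right, show x - (s + t) = x - t - s by abel]
  have phase :
      Complex.exp (((-2 * Real.pi * ⟪t, s⟫_ℝ * Real.cot θ : ℝ) : ℂ) * Complex.I) *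
        Complex.exp (((-2 * Real.pi * ⟪s + t, x - t - s⟫_ℝ * Real.cot θ : ℝ) : ℂ) * Complex.I) =
      Complex.exp (((-2 * Real.pi * ⟪t, x - t⟫_ℝ * Real.cot θ : ℝ) : ℂ) * Complex.I) *
        Complex.exp (((-2 * Real.pi * ⟪s, x - t - s⟫_ℝ * Real.cot θ : ℝ) : ℂ) * Complex.I) := by
    rw [← Complex.exp_add, ← Complex.exp_add, inner_add_left, inner_sub_right t (x - t) s]
    congr 1
    push_cast
    ring
  linear_combination f s * g (x - t - s) * phase

theorem thetaDil_thetaTrans (θ : ℝ) {r : ℝ} (hr : r ≠ 0) (t : Rn n) (h : Rn n → ℂ) (x : Rn n) :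
    thetaDil θ r (thetaTrans θ t h) x =
      Complex.exp (((Real.pi * ⟪t, t⟫_ℝ * Real.cot θ : ℝ) : ℂ) * Complex.I) *
      Complex.exp (((-Real.pi * (⟪t, t⟫_ℝ / r ^ 2) * Real.cot θ : ℝ) : ℂ) * Complex.I) *
      thetaTrans θ (r⁻¹ • t) (thetaDil θ r h) x := by
  have cot_neg : Real.cot (-θ) = -Real.cot θ := by
    simp [Real.cot_eq_cos_div_sin, div_neg]
  simp only [thetaDil, thetaTrans, chirp, dil, cot_neg]
  rw [smul_sub, smul_inv_smul₀ hr]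
  have phase :
      Complex.exp (((Real.pi * ⟪x, x⟫_ℝ * -Real.cot θ : ℝ) : ℂ) * Complex.I) *
        Complex.exp (((Real.pi * ⟪r • x, r • x⟫_ℝ * Real.cot θ : ℝ) : ℂ) * Complex.I) *
        Complex.exp (((-2 * Real.pi * ⟪t, r • x - t⟫_ℝ * Real.cot θ : ℝ) : ℂ) * Complex.I) =
      Complex.exp (((Real.pi * ⟪t, t⟫_ℝ * Real.cot θ : ℝ) : ℂ) * Complex.I) *
        Complex.exp (((-Real.pi * (⟪t, t⟫_ℝ / r ^ 2) * Real.cot θ : ℝ) : ℂ) * Complex.I) *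
        Complex.exp (((-2 * Real.pi * ⟪r⁻¹ • t, x - r⁻¹ • t⟫_ℝ * Real.cot θ : ℝ) : ℂ) *
          Complex.I) *
        Complex.exp (((Real.pi * ⟪x - r⁻¹ • t, x - r⁻¹ • t⟫_ℝ * -Real.cot θ : ℝ) : ℂ) *
          Complex.I) *
        Complex.exp (((Real.pi * ⟪r • x - t, r • x - t⟫_ℝ * Real.cot θ : ℝ) : ℂ) *
          Complex.I) := by
    simp only [← Complex.exp_add, ← add_mul, ← Complex.ofReal_add]
    congr 3
    simp only [inner_sub_left, inner_sub_right, real_inner_smul_left, real_inner_smul_right,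
      real_inner_comm x t]
    field_simp
    ring
  linear_combination ((r ^ ((n : ℝ) / 2) : ℝ) : ℂ) * h (r • x - t) * phase

/-- If `M, P` map `L²(ℝⁿ)` to itself and commute with all θ-translations,
then for `g ∈ L¹ ∩ L²`, `r > 0`, `t ∈ ℝⁿ`, `f ∈ L²(ℝⁿ)`:
`D_r^θ P M ((T_t^θ f) ⋆_θ g) = e^{πi (t·t) cot θ} e^{-πi ((t·t)/r²) cot θ} T_{t/r}^θ D_r^θ P M (f ⋆_θ g)`
in `L²(ℝⁿ)`. -/
theorem statement5 (n : ℕ) (hn : 1 ≤ n) (θ : ℝ) (hθ : Real.sin θ ≠ 0)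
    (g : Rn n → ℂ) (hg1 : Integrable g (volume : Measure (Rn n)))
    (hg2 : MemLp g 2 (volume : Measure (Rn n)))
    (r : ℝ) (hr : 0 < r) (t : Rn n)
    (M P : (Rn n → ℂ) → Rn n → ℂ)
    (hML2 : ∀ h : Rn n → ℂ, MemLp h 2 (volume : Measure (Rn n)) →
      MemLp (M h) 2 (volume : Measure (Rn n)))
    (hPL2 : ∀ h : Rn n → ℂ, MemLp h 2 (volume : Measure (Rn n)) →
      MemLp (P h) 2 (volume : Measure (Rn n)))
    (hMcomm : ∀ (u : Rn n) (h : Rn n → ℂ), M (thetaTrans θ u h) = thetaTrans θ u (M h))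
    (hPcomm : ∀ (u : Rn n) (h : Rn n → ℂ), P (thetaTrans θ u h) = thetaTrans θ u (P h)) :
    ∀ f : Rn n → ℂ, MemLp f 2 (volume : Measure (Rn n)) →
      thetaDil θ r (P (M (thetaConv θ (thetaTrans θ t f) g))) =ᵐ[(volume : Measure (Rn n))]
        fun x =>
          Complex.exp (((Real.pi * ⟪t, t⟫_ℝ * Real.cot θ : ℝ) : ℂ) * Complex.I) *
          Complex.exp (((-Real.pi * (⟪t, t⟫_ℝ / r ^ 2) * Real.cot θ : ℝ) : ℂ) * Complex.I) *
          thetaTrans θ (r⁻¹ • t) (thetaDil θ r (P (M (thetaConv θ f g)))) x := by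
  intro f _
  rw [thetaConv_thetaTrans_left, hMcomm, hPcomm]
  exact .of_forall (thetaDil_thetaTrans θ hr.ne' t _)
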